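/- There is no two-dimensional scoring rule S : [0,1]² → ℝ⁴ that is strictly proper, satisfies the technical assumptions (continuity on [0,1]², differentiability on (0,1)², and componentwise quasiconcavity), and satisfies the budget-constrained truthfulness property. -/

import Mathlib

open scoped BigOperators

noncomputable section

/-- The space of reports `[0,1]²`: a pair `(q_T, q_L)` of probabilities for the independent
events `Top` and `Left`. -/
def box2 : Set (ℝ × ℝ) := Set.Icc (0:ℝ) 1 ×ˢ Set.Icc (0:ℝ) 1

/-- The open square `(0,1)²`. -/
def openBox2 : Set (ℝ × ℝ) := Set.Ioo (0:ℝ) 1 ×ˢ Set.Ioo (0:ℝ) 1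

/-- The implied product distribution `q̂ = (q_T q_L, q_T(1−q_L), (1−q_T)q_L, (1−q_T)(1−q_L))`
over the four outcomes `(TL, TR, BL, BR)` (identified with `0, 1, 2, 3`). -/
def hat2 (q : ℝ × ℝ) : Fin 4 → ℝ :=
  ![q.1 * q.2, q.1 * (1 - q.2), (1 - q.1) * q.2, (1 - q.1) * (1 - q.2)]

/-- Dot product of two vectors in `ℝ⁴`. -/
def dot4 (p s : Fin 4 → ℝ) : ℝ := ∑ i, p i * s i

/-- A two-dimensional scoring rule `S : [0,1]² → ℝ⁴` is strictly proper if for all `p ≠ q` in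
`[0,1]²`, `p̂·S(p) > p̂·S(q)`. -/
def StrictlyProper2D (S : ℝ × ℝ → Fin 4 → ℝ) : Prop :=
  ∀ p ∈ box2, ∀ q ∈ box2, p ≠ q → dot4 (hat2 p) (S q) < dot4 (hat2 p) (S p)

/-- Each component `S_o` is quasiconcave: `S_o(½p + ½q) ≥ min (S_o p) (S_o q)`, with equality
only if `S_o p = S_o q`. -/
def QuasiConcave2D (S : ℝ × ℝ → Fin 4 → ℝ) : Prop :=
  ∀ o : Fin 4, ∀ p ∈ box2, ∀ q ∈ box2,
    min (S p o) (S q o) ≤ S ((1/2 : ℝ) • p + (1/2 : ℝ) • q) o ∧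
    (S ((1/2 : ℝ) • p + (1/2 : ℝ) • q) o = min (S p o) (S q o) → S p o = S q o)

/-- The technical assumptions: continuity on `[0,1]²`, differentiability on `(0,1)²`, and
componentwise quasiconcavity. -/
def Tech2D (S : ℝ × ℝ → Fin 4 → ℝ) : Prop :=
  ContinuousOn S box2 ∧ DifferentiableOn ℝ S openBox2 ∧ QuasiConcave2D S

/-- The natural budget required to move from `q₀` to `q`: `max_o (S_o(q₀) − S_o(q))` over the
four outcomes. -/
def nb4 (S : ℝ × ℝ → Fin 4 → ℝ) (q₀ q : ℝ × ℝ) : ℝ :=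
  max (max (S q₀ 0 - S q 0) (S q₀ 1 - S q 1)) (max (S q₀ 2 - S q 2) (S q₀ 3 - S q 3))

/-- The budget-constrained truthfulness property: for every belief `p`, reference point `q₀`
and budget `b > 0`, the expected score `p̂·S(q)` over feasible reports (`q ∈ [0,1]²` with
`nb(q₀,q) ≤ b`) is uniquely maximized at `q* = α p + (1−α) q₀`, where `α` is the greatest
element of `{α ∈ [0,1] : nb(q₀, α p + (1−α) q₀) ≤ b}`. -/
def BCT2D (S : ℝ × ℝ → Fin 4 → ℝ) : Prop :=
  ∀ p ∈ box2, ∀ q₀ ∈ box2, ∀ b : ℝ, 0 < b →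
    ∃ α : ℝ,
      IsGreatest {a : ℝ | a ∈ Set.Icc (0:ℝ) 1 ∧
        nb4 S q₀ (a • p + (1 - a) • q₀) ≤ b} α ∧
      ∀ q ∈ box2, nb4 S q₀ q ≤ b → q ≠ α • p + (1 - α) • q₀ →
        dot4 (hat2 p) (S q) < dot4 (hat2 p) (S (α • p + (1 - α) • q₀))

theorem aux_line (f : ℝ → ℝ) (hc : ContinuousOn f (Set.Icc 0 1))
    (hq : ∀ s ∈ Set.Icc (0:ℝ) 1, ∀ t ∈ Set.Icc (0:ℝ) 1,
      min (f s) (f t) ≤ f ((s + t) / 2) ∧ (f ((s + t) / 2) = min (f s) (f t) → f s = f t))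
    (a t : ℝ) (ha : 0 < a) (hat : a < t) (ht : t ≤ 1) (h0 : f a < f 0) : f t < f a := by
  by_contra hcon
  push Not at hcon
  have hsub : Set.Icc 0 t ⊆ Set.Icc (0:ℝ) 1 := Set.Icc_subset_Icc le_rfl ht
  have hct : ContinuousOn f (Set.Icc 0 t) := hc.mono hsub
  obtain ⟨m, hm, hmin⟩ := isCompact_Icc.exists_isMinOn (s := Set.Icc 0 t)
    ⟨a, ha.le, hat.le⟩ hct
  have hK : IsCompact (Set.Icc 0 t ∩ f ⁻¹' {f m}) :=
    isCompact_Icc.of_isClosed_subset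
      (hct.preimage_isClosed_of_isClosed isClosed_Icc isClosed_singleton) Set.inter_subset_left
  obtain ⟨c, ⟨hc1, hc2⟩, hcl⟩ := hK.exists_isLeast ⟨m, hm, rfl⟩
  have hc2 : f c = f m := hc2
  have hmin' : ∀ x ∈ Set.Icc 0 t, f m ≤ f x := fun x hx => hmin hx
  have hma : f m ≤ f a := hmin' a ⟨ha.le, hat.le⟩
  have hc0 : 0 < c := by
    rcases hc1.1.lt_or_eq with h | h
    · exact h
    · rw [← h] at hc2; linarith
  have hctt : c < t := by
    rcases hc1.2.lt_or_eq with h | h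
    · exact h
    · have : f a = f m := by rw [h] at hc2; linarith
      have := hcl ⟨⟨ha.le, hat.le⟩, this⟩
      linarith
  obtain ⟨δ, hδ, hδ1, hδ2⟩ : ∃ δ : ℝ, 0 < δ ∧ δ ≤ c ∧ δ ≤ t - c :=
    ⟨min c (t - c), lt_min hc0 (by linarith), min_le_left _ _, min_le_right _ _⟩
  have i1 : c - δ ∈ Set.Icc 0 t := ⟨by linarith, by linarith⟩
  have i2 : c + δ ∈ Set.Icc 0 t := ⟨by linarith, by linarith⟩
  obtain ⟨q1, q2⟩ := hq _ (hsub i1) _ (hsub i2)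
  rw [show (c - δ + (c + δ)) / 2 = c by ring] at q1 q2
  have e1 := hmin' _ i1
  have e2 := hmin' _ i2
  have e3 : f c = min (f (c - δ)) (f (c + δ)) := le_antisymm (hc2 ▸ le_min e1 e2) q1
  have e4 := q2 e3
  rw [← e4, min_self] at e3
  have := hcl ⟨i1, show f (c - δ) = f m by rw [← e3, hc2]⟩
  linarith

theorem aux_mem {p : ℝ × ℝ} : p ∈ box2 ↔ (0 ≤ p.1 ∧ p.1 ≤ 1) ∧ (0 ≤ p.2 ∧ p.2 ≤ 1) := by
  exact Iff.rfl

theorem aux_dot (p : ℝ × ℝ) (s : Fin 4 → ℝ) : dot4 (hat2 p) s =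
    p.1 * p.2 * s 0 + p.1 * (1 - p.2) * s 1 + (1 - p.1) * p.2 * s 2
      + (1 - p.1) * (1 - p.2) * s 3 := by
  simp [dot4, hat2, Fin.sum_univ_four]

theorem aux_nb_le (S : ℝ × ℝ → Fin 4 → ℝ) (q₀ q : ℝ × ℝ) (b : ℝ) :
    nb4 S q₀ q ≤ b ↔ ∀ o, S q₀ o - S q o ≤ b := by
  simp [nb4, Fin.forall_fin_succ, and_assoc]

theorem aux_conv {p q : ℝ × ℝ} (hp : p ∈ box2) (hq : q ∈ box2) {a : ℝ} (h0 : 0 ≤ a)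
    (h1 : a ≤ 1) : a • p + (1 - a) • q ∈ box2 := by
  have hc : Convex ℝ box2 := (convex_Icc 0 1).prod (convex_Icc 0 1)
  exact hc hp hq h0 (by linarith) (by ring)

theorem aux_pos {S : ℝ × ℝ → Fin 4 → ℝ} (hS : StrictlyProper2D S) {q₀ q : ℝ × ℝ}
    (h0 : q₀ ∈ box2) (hq : q ∈ box2) (hne : q₀ ≠ q) (b : ℝ)
    (hb : ∀ o, S q₀ o - S q o ≤ b) : 0 < b := by
  have h := hS q₀ h0 q hq hne
  rw [aux_dot, aux_dot] at h
  obtain ⟨⟨h1, h2⟩, h3, h4⟩ := aux_mem.1 h0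
  have a0 := mul_le_mul_of_nonneg_left (hb 0) (mul_nonneg h1 h3)
  have a1 := mul_le_mul_of_nonneg_left (hb 1) (mul_nonneg h1 (sub_nonneg.2 h4))
  have a2 := mul_le_mul_of_nonneg_left (hb 2) (mul_nonneg (sub_nonneg.2 h2) h3)
  have a3 := mul_le_mul_of_nonneg_left (hb 3) (mul_nonneg (sub_nonneg.2 h2) (sub_nonneg.2 h4))
  nlinarith

/-- If BL and BR are tied as most costly outcomes, the L-coordinates agree. -/
theorem aux_tieB {S : ℝ × ℝ → Fin 4 → ℝ} (hS : StrictlyProper2D S) (hB : BCT2D S)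
    {q₀ q : ℝ × ℝ} (h0 : q₀ ∈ box2) (hq : q ∈ box2) (hx0 : 0 < q.1) (hx1 : q.1 < 1)
    (hne : q₀.2 ≠ q.2) (htie : S q₀ 2 - S q 2 = S q₀ 3 - S q 3)
    (hmax : ∀ o, S q₀ o - S q o ≤ S q₀ 2 - S q 2) : False := by
  have hb := aux_pos hS h0 hq (fun h => hne (by rw [h])) _ hmax
  obtain ⟨_, hy0, hy1⟩ := aux_mem.1 hq
  have hp : ((1, q.2) : ℝ × ℝ) ∈ box2 := aux_mem.2 (by simp [hy0, hy1])
  obtain ⟨α, ⟨⟨⟨ha0, ha1⟩, hfe⟩, _⟩, hopt⟩ := hB _ hp q₀ h0 _ hb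
  have hr := aux_conv hp h0 ha0 ha1
  set r := α • ((1, q.2) : ℝ × ℝ) + (1 - α) • q₀ with hrdef
  by_cases hrq : q = r
  · have e1 : q.1 = α * 1 + (1 - α) * q₀.1 := by
      conv_lhs => rw [hrq]
      simp [hrdef]
    have e2 : q.2 = α * q.2 + (1 - α) * q₀.2 := by
      conv_lhs => rw [hrq]
      simp [hrdef]
    have : (1 - α) * (q₀.2 - q.2) = 0 := by linarith
    rcases mul_eq_zero.1 this with h | h
    · rw [h] at e1
      linarith
    · exact hne (by linarith)
  · have h1 := hopt q hq ((aux_nb_le _ _ _ _).2 hmax) hrq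
    have hf := (aux_nb_le _ _ _ _).1 hfe
    have h2 := hS q hq r hr hrq
    rw [aux_dot, aux_dot] at h1 h2
    simp only at h1
    have f2 := hf 2
    have f3 := hf 3
    have g2 : 0 ≤ (1 - q.1) * q.2 * (S r 2 - S q 2) :=
      mul_nonneg (mul_nonneg (by linarith) hy0) (by linarith)
    have g3 : 0 ≤ (1 - q.1) * (1 - q.2) * (S r 3 - S q 3) :=
      mul_nonneg (mul_nonneg (by linarith) (by linarith)) (by linarith)
    have := mul_lt_mul_of_pos_left h1 hx0
    nlinarith

/-- If TL and BL are tied as most costly outcomes, the T-coordinates agree. -/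
theorem aux_tieL {S : ℝ × ℝ → Fin 4 → ℝ} (hS : StrictlyProper2D S) (hB : BCT2D S)
    {q₀ q : ℝ × ℝ} (h0 : q₀ ∈ box2) (hq : q ∈ box2) (hx0 : 0 < q.2) (hx1 : q.2 < 1)
    (hne : q₀.1 ≠ q.1) (htie : S q₀ 2 - S q 2 = S q₀ 0 - S q 0)
    (hmax : ∀ o, S q₀ o - S q o ≤ S q₀ 2 - S q 2) : False := by
  have hb := aux_pos hS h0 hq (fun h => hne (by rw [h])) _ hmax
  obtain ⟨⟨hy0, hy1⟩, _⟩ := aux_mem.1 hq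
  have hp : ((q.1, 0) : ℝ × ℝ) ∈ box2 := aux_mem.2 (by simp [hy0, hy1])
  obtain ⟨α, ⟨⟨⟨ha0, ha1⟩, hfe⟩, _⟩, hopt⟩ := hB _ hp q₀ h0 _ hb
  have hr := aux_conv hp h0 ha0 ha1
  set r := α • ((q.1, 0) : ℝ × ℝ) + (1 - α) • q₀ with hrdef
  by_cases hrq : q = r
  · have e1 : q.2 = α * 0 + (1 - α) * q₀.2 := by
      conv_lhs => rw [hrq]
      simp [hrdef]
    have e2 : q.1 = α * q.1 + (1 - α) * q₀.1 := by
      conv_lhs => rw [hrq]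
      simp [hrdef]
    have : (1 - α) * (q₀.1 - q.1) = 0 := by linarith
    rcases mul_eq_zero.1 this with h | h
    · rw [h] at e1
      linarith
    · exact hne (by linarith)
  · have h1 := hopt q hq ((aux_nb_le _ _ _ _).2 hmax) hrq
    have hf := (aux_nb_le _ _ _ _).1 hfe
    have h2 := hS q hq r hr hrq
    rw [aux_dot, aux_dot] at h1 h2
    simp only at h1
    have f2 := hf 2
    have f0 := hf 0
    have g2 : 0 ≤ (1 - q.1) * q.2 * (S r 2 - S q 2) :=
      mul_nonneg (mul_nonneg (by linarith) hx0.le) (by linarith)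
    have g0 : 0 ≤ q.1 * q.2 * (S r 0 - S q 0) :=
      mul_nonneg (mul_nonneg (by linarith) (by linarith)) (by linarith)
    have := mul_lt_mul_of_pos_left h1 (sub_pos.2 hx1)
    nlinarith

/-- Two reports with the same score in the active outcome compare. -/
theorem aux_cmp {S : ℝ × ℝ → Fin 4 → ℝ} (hS : StrictlyProper2D S) (hT : Tech2D S) (hB : BCT2D S)
    {o : Fin 4} {p Q q q' : ℝ × ℝ} (hp : p ∈ box2) (hQ : Q ∈ box2) (hq : q ∈ box2)
    (hq' : q' ∈ box2) (hne : Q ≠ q) {a : ℝ} (ha0 : 0 < a) (ha1 : a < 1)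
    (hqa : q = a • p + (1 - a) • Q) (heq : S q o = S q' o)
    (h1 : ∀ j, S Q j - S q j ≤ S Q o - S q o)
    (h2 : ∀ j, S Q j - S q' j ≤ S Q o - S q' o) :
    dot4 (hat2 p) (S q') ≤ dot4 (hat2 p) (S q) := by
  have hb := aux_pos hS hQ hq hne _ h1
  obtain ⟨α, ⟨⟨⟨hα0, hα1⟩, hfe⟩, hgr⟩, hopt⟩ := hB p hp Q hQ _ hb
  have haα : a ≤ α := hgr ⟨⟨ha0.le, ha1.le⟩, by rw [← hqa]; exact (aux_nb_le _ _ _ _).2 h1⟩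
  have hαa : α = a := by
    by_contra hn
    have hlt : a < α := lt_of_le_of_ne haα (Ne.symm hn)
    have hl := aux_line (fun t => S (t • p + (1 - t) • Q) o) ?_ ?_ a α ha0 hlt hα1 ?_
    · have := (aux_nb_le _ _ _ _).1 hfe o
      simp only [← hqa] at hl
      linarith
    · have hS1 : ContinuousOn (fun x => S x o) box2 :=
        (continuous_apply o).comp_continuousOn hT.1
      refine hS1.comp (f := fun t : ℝ => t • p + (1 - t) • Q) (by fun_prop) ?_
      intro t ht
      exact aux_conv hp hQ ht.1 ht.2
    · intro s hs t ht
      have := hT.2.2 o _ (aux_conv hp hQ hs.1 hs.2) _ (aux_conv hp hQ ht.1 ht.2)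
      have e : (1/2 : ℝ) • (s • p + (1 - s) • Q) + (1/2 : ℝ) • (t • p + (1 - t) • Q)
          = ((s + t) / 2) • p + (1 - (s + t) / 2) • Q := by module
      rw [e] at this
      exact this
    · simp only [← hqa]
      simp
      linarith
  by_cases hqq : q' = q
  · rw [hqq]
  · rw [hαa, ← hqa] at hopt
    exact (hopt q' hq' ((aux_nb_le _ _ _ _).2 (by rw [heq]; exact h2)) hqq).le

theorem aux_noninj_seg {f : ℝ × ℝ → ℝ} {U : Set (ℝ × ℝ)} (hf : ContinuousOn f U)
    (hU : Convex ℝ U) {A B C : ℝ × ℝ} (hA : A ∈ U) (hC : C ∈ U)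
    (hn : B ∉ segment ℝ A C) (h1 : f A ≤ f B) (h2 : f B ≤ f C) :
    ∃ q ∈ U, q ≠ B ∧ f q = f B := by
  have hseg : IsPreconnected (segment ℝ A C) := (convex_segment A C).isPreconnected
  have hsub := hU.segment_subset hA hC
  obtain ⟨q, hq, he⟩ := hseg.intermediate_value (left_mem_segment ℝ A C)
    (right_mem_segment ℝ A C) (hf.mono hsub) ⟨h1, h2⟩
  exact ⟨q, hsub hq, fun h => hn (h ▸ hq), he⟩

theorem aux_noninj {f : ℝ × ℝ → ℝ} {U : Set (ℝ × ℝ)} (hf : ContinuousOn f U)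
    (hU : Convex ℝ U) {x y h : ℝ} (hh : 0 < h) (hA : (x, y) ∈ U) (hB : (x + h, y) ∈ U)
    (hC : (x, y + h) ∈ U) : ∃ q ∈ U, ∃ q' ∈ U, q ≠ q' ∧ f q = f q' := by
  have nA : ((x, y) : ℝ × ℝ) ∉ segment ℝ (x + h, y) (x, y + h) := by
    rintro ⟨a, b, ha, hb, hab, he⟩
    simp only [Prod.smul_mk, Prod.mk_add_mk, Prod.mk.injEq, smul_eq_mul] at he
    obtain rfl : b = 1 - a := by linarith
    have e1 := he.1
    have e2 := he.2
    ring_nf at e1 e2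
    nlinarith
  have nB : ((x + h, y) : ℝ × ℝ) ∉ segment ℝ (x, y) (x, y + h) := by
    rintro ⟨a, b, ha, hb, hab, he⟩
    simp only [Prod.smul_mk, Prod.mk_add_mk, Prod.mk.injEq, smul_eq_mul] at he
    obtain rfl : b = 1 - a := by linarith
    have e1 := he.1
    have e2 := he.2
    ring_nf at e1 e2
    nlinarith
  have nC : ((x, y + h) : ℝ × ℝ) ∉ segment ℝ (x, y) (x + h, y) := by
    rintro ⟨a, b, ha, hb, hab, he⟩
    simp only [Prod.smul_mk, Prod.mk_add_mk, Prod.mk.injEq, smul_eq_mul] at he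
    obtain rfl : b = 1 - a := by linarith
    have e1 := he.1
    have e2 := he.2
    ring_nf at e1 e2
    nlinarith
  have key : ∀ {A B C : ℝ × ℝ}, A ∈ U → B ∈ U → C ∈ U → B ∉ segment ℝ A C → f A ≤ f B →
      f B ≤ f C → ∃ q ∈ U, ∃ q' ∈ U, q ≠ q' ∧ f q = f q' := by
    intro A B C hA hB hC hn h1 h2
    obtain ⟨q, h3, h4, h5⟩ := aux_noninj_seg hf hU hA hC hn h1 h2
    exact ⟨q, h3, B, hB, h4, h5⟩
  rcases le_total (f (x, y)) (f (x + h, y)) with h1 | h1 <;>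
  rcases le_total (f (x, y)) (f (x, y + h)) with h2 | h2 <;>
  rcases le_total (f (x + h, y)) (f (x, y + h)) with h3 | h3
  · exact key hA hB hC nB h1 h3
  · exact key hA hC hB nC h2 h3
  · exact key hC hA hB (segment_symm ℝ (x + h, y) (x, y + h) ▸ nA) h2 h1
  · exact key hC hA hB (segment_symm ℝ (x + h, y) (x, y + h) ▸ nA) h2 h1
  · exact key hB hA hC nA h1 h2
  · exact key hB hA hC nA h1 h2
  · exact key hB hC hA (segment_symm ℝ (x, y) (x + h, y) ▸ nC) h3 h2
  · exact key hC hB hA (segment_symm ℝ (x, y) (x, y + h) ▸ nB) h3 h1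

theorem aux_nhds {q : ℝ × ℝ} (h : q ∈ openBox2) : box2 ∈ nhds q := by
  have ho : IsOpen openBox2 := isOpen_Ioo.prod isOpen_Ioo
  exact Filter.mem_of_superset (ho.mem_nhds h)
    (Set.prod_mono Set.Ioo_subset_Icc_self Set.Ioo_subset_Icc_self)

/-- A strictly most costly outcome is impossible. -/
theorem aux_unique {S : ℝ × ℝ → Fin 4 → ℝ} (hS : StrictlyProper2D S) (hT : Tech2D S)
    (hB : BCT2D S) {o : Fin 4} {q₀ q₁ : ℝ × ℝ} (h0 : q₀ ∈ openBox2) (h1 : q₁ ∈ openBox2)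
    (hne : q₀ ≠ q₁) (hst : ∀ j, j ≠ o → S q₀ j - S q₁ j < S q₀ o - S q₁ o) : False := by
  have ho : IsOpen openBox2 := isOpen_Ioo.prod isOpen_Ioo
  have cont : ∀ q ∈ openBox2, ∀ j, ContinuousAt (fun x => S x j) q := fun q hq j =>
    (continuous_apply j).continuousAt.comp (hT.1.continuousAt (aux_nhds hq))
  -- choose the step
  obtain ⟨δ, hδ, hpδ⟩ : ∃ δ : ℝ, 0 < δ ∧ q₁ + δ • (q₁ - q₀) ∈ openBox2 := by
    have hc : ContinuousAt (fun δ : ℝ => q₁ + δ • (q₁ - q₀)) 0 := by fun_prop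
    have : ∀ᶠ δ in nhds (0:ℝ), q₁ + δ • (q₁ - q₀) ∈ openBox2 :=
      hc (ho.mem_nhds (by simpa using h1))
    obtain ⟨ε, hε, hb⟩ := Metric.eventually_nhds_iff.1 this
    refine ⟨ε / 2, by positivity, hb ?_⟩
    rw [Real.dist_eq, sub_zero, abs_of_pos (by positivity)]
    linarith
  set p₁ := q₁ + δ • (q₁ - q₀) with hp₁
  let F : ℝ × ℝ → ℝ × ℝ → ℝ × ℝ := fun p q => δ⁻¹ • ((1 + δ) • q - p)
  have hF1 : F p₁ q₁ = q₀ := by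
    have : (1 + δ) • q₁ - p₁ = δ • q₀ := by rw [hp₁]; module
    simp only [F]
    rw [this, smul_smul, inv_mul_cancel₀ hδ.ne', one_smul]
  have hF2 : ∀ p q, q = (1 / (1 + δ)) • p + (1 - 1 / (1 + δ)) • F p q := by
    intro p q
    have hd : (1 + δ) ≠ 0 := by positivity
    ext <;> simp [F] <;> field_simp <;> ring
  have hFc : Continuous (fun z : (ℝ × ℝ) × (ℝ × ℝ) => F z.1 z.2) := by
    simp only [F]; fun_prop
  let z₁ : (ℝ × ℝ) × (ℝ × ℝ) × (ℝ × ℝ) := (p₁, q₁, q₁)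
  have cF : ContinuousAt (fun z : (ℝ × ℝ) × (ℝ × ℝ) × (ℝ × ℝ) => F z.1 z.2.1) z₁ := by
    have : Continuous (fun z : (ℝ × ℝ) × (ℝ × ℝ) × (ℝ × ℝ) => F z.1 z.2.1) := by
      simp only [F]; fun_prop
    exact this.continuousAt
  have cq : ContinuousAt (fun z : (ℝ × ℝ) × (ℝ × ℝ) × (ℝ × ℝ) => z.2.1) z₁ := by fun_prop
  have cq' : ContinuousAt (fun z : (ℝ × ℝ) × (ℝ × ℝ) × (ℝ × ℝ) => z.2.2) z₁ := by fun_prop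
  have cp : ContinuousAt (fun z : (ℝ × ℝ) × (ℝ × ℝ) × (ℝ × ℝ) => z.1) z₁ := by fun_prop
  have cSF : ∀ j, ContinuousAt (fun z : (ℝ × ℝ) × (ℝ × ℝ) × (ℝ × ℝ) => S (F z.1 z.2.1) j) z₁ :=
    fun j => ContinuousAt.comp (g := fun x => S x j)
      (cont _ (show F z₁.1 z₁.2.1 ∈ openBox2 from hF1.symm ▸ h0) j) cF
  have cSq : ∀ j, ContinuousAt (fun z : (ℝ × ℝ) × (ℝ × ℝ) × (ℝ × ℝ) => S z.2.1 j) z₁ :=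
    fun j => ContinuousAt.comp (g := fun x => S x j) (cont _ h1 j) cq
  have cSq' : ∀ j, ContinuousAt (fun z : (ℝ × ℝ) × (ℝ × ℝ) × (ℝ × ℝ) => S z.2.2 j) z₁ :=
    fun j => ContinuousAt.comp (g := fun x => S x j) (cont _ h1 j) cq'
  have eF : ∀ᶠ z in nhds z₁, F z.1 z.2.1 ∈ box2 :=
    cF (aux_nhds (show F z₁.1 z₁.2.1 ∈ openBox2 from hF1.symm ▸ h0))
  have eq : ∀ᶠ z in nhds z₁, z.2.1 ∈ box2 := cq (aux_nhds h1)
  have eq' : ∀ᶠ z in nhds z₁, z.2.2 ∈ box2 := cq' (aux_nhds h1)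
  have ep : ∀ᶠ z in nhds z₁, z.1 ∈ box2 := cp (aux_nhds hpδ)
  have en : ∀ᶠ z in nhds z₁, F z.1 z.2.1 ≠ z.2.1 :=
    ((cF.sub cq).eventually_ne (y := 0)
      (show F p₁ q₁ - q₁ ≠ 0 from sub_ne_zero.2 (hF1.symm ▸ hne))).mono
      fun z hz => sub_ne_zero.1 hz
  have e1 : ∀ᶠ z in nhds z₁, ∀ j, S (F z.1 z.2.1) j - S z.2.1 j ≤
      S (F z.1 z.2.1) o - S z.2.1 o := by
    refine Filter.eventually_all.2 fun j => ?_
    by_cases hj : j = o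
    · subst hj; simp
    · refine (((cSF j).sub (cSq j)).eventually_lt ((cSF o).sub (cSq o)) ?_).mono
        fun z hz => hz.le
      simp only [z₁, Pi.sub_apply, hF1]
      exact hst j hj
  have e2 : ∀ᶠ z in nhds z₁, ∀ j, S (F z.1 z.2.1) j - S z.2.2 j ≤
      S (F z.1 z.2.1) o - S z.2.2 o := by
    refine Filter.eventually_all.2 fun j => ?_
    by_cases hj : j = o
    · subst hj; simp
    · refine (((cSF j).sub (cSq' j)).eventually_lt ((cSF o).sub (cSq' o)) ?_).mono
        fun z hz => hz.le
      simp only [z₁, Pi.sub_apply, hF1]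
      exact hst j hj
  obtain ⟨ε, hε, hball⟩ := Metric.eventually_nhds_iff.1
    (eF.and (eq.and (eq'.and (ep.and (en.and (e1.and e2))))))
  have cmp : ∀ p q q', dist p p₁ < ε → dist q q₁ < ε → dist q' q₁ < ε → S q o = S q' o →
      dot4 (hat2 p) (S q') ≤ dot4 (hat2 p) (S q) := by
    intro p q q' hp hq hq' he
    have hd : dist (p, q, q') z₁ < ε := by
      simp only [z₁, Prod.dist_eq (α := ℝ × ℝ) (β := (ℝ × ℝ) × (ℝ × ℝ))]
      refine max_lt hp ?_
      rw [Prod.dist_eq (α := ℝ × ℝ) (β := ℝ × ℝ)]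
      exact max_lt hq hq'
    obtain ⟨a1, a2, a3, a4, a5, a6, a7⟩ := hball hd
    exact aux_cmp hS hT hB a4 a1 a2 a3 a5 (a := 1 / (1 + δ)) (by positivity)
      (by rw [div_lt_one (by positivity)]; linarith) (hF2 p q) he a6 a7
  have inb : ∀ q, dist q q₁ < ε → q ∈ box2 := by
    intro q hq
    have hd : dist (p₁, q, q₁) z₁ < ε := by
      simp only [z₁, Prod.dist_eq (α := ℝ × ℝ) (β := (ℝ × ℝ) × (ℝ × ℝ))]
      refine max_lt (by simpa using hε) ?_
      rw [Prod.dist_eq (α := ℝ × ℝ) (β := ℝ × ℝ)]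
      exact max_lt hq (by simpa using hε)
    exact (hball hd).2.1
  have hoff : ∀ (c : ℝ × ℝ) (s t : ℝ), |s| < ε → |t| < ε →
      dist ((c.1 + s, c.2 + t) : ℝ × ℝ) c < ε := by
    intro c s t hs ht
    rw [Prod.dist_eq, Real.dist_eq, Real.dist_eq]
    simpa using ⟨hs, ht⟩
  have hh : |ε / 2| < ε := by rw [abs_of_pos (by positivity)]; linarith
  have h00 : |(0:ℝ)| < ε := by simpa using hε
  have m0 := hoff q₁ 0 0 h00 h00
  have m1 := hoff q₁ (ε / 2) 0 hh h00
  have m2 := hoff q₁ 0 (ε / 2) h00 hh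
  simp only [add_zero] at m0 m1 m2
  have hcf : ContinuousOn (fun x => S x o) (Metric.ball q₁ ε) :=
    (((continuous_apply o).comp_continuousOn hT.1).mono fun q hq => inb q hq)
  obtain ⟨q, hq, q', hq', hqq, he⟩ := aux_noninj hcf (convex_ball _ _) (half_pos hε) m0 m1 m2
  have heqs : ∀ s t : ℝ, |s| < ε → |t| < ε →
      dot4 (hat2 (p₁.1 + s, p₁.2 + t)) (S q') = dot4 (hat2 (p₁.1 + s, p₁.2 + t)) (S q) :=
    fun s t hs ht => le_antisymm (cmp _ _ _ (hoff p₁ s t hs ht) hq hq' he)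
      (cmp _ _ _ (hoff p₁ s t hs ht) hq' hq he.symm)
  have k0 := heqs 0 0 h00 h00
  have k1 := heqs (ε / 2) 0 hh h00
  have k2 := heqs 0 (ε / 2) h00 hh
  have k3 := heqs (ε / 2) (ε / 2) hh hh
  simp only [aux_dot] at k0 k1 k2 k3
  have hcon := hS q (inb q hq) q' (inb q' hq') hqq
  rw [aux_dot, aux_dot] at hcon
  generalize hk : ε / 2 = k at k1 k2 k3
  have hk0 : k ≠ 0 := by rw [← hk]; positivity
  generalize p₁.1 = x at k0 k1 k2 k3
  generalize p₁.2 = y at k0 k1 k2 k3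
  obtain ⟨d0, hd0⟩ : ∃ d, d = S q' 0 - S q 0 := ⟨_, rfl⟩
  obtain ⟨d1, hd1⟩ : ∃ d, d = S q' 1 - S q 1 := ⟨_, rfl⟩
  obtain ⟨d2, hd2⟩ : ∃ d, d = S q' 2 - S q 2 := ⟨_, rfl⟩
  obtain ⟨d3, hd3⟩ : ∃ d, d = S q' 3 - S q 3 := ⟨_, rfl⟩
  have D : d0 - d1 - d2 + d3 = 0 := by
    have : k * k * (d0 - d1 - d2 + d3) = 0 := by
      rw [hd0, hd1, hd2, hd3]; linear_combination k3 - k1 - k2 + k0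
    simpa [hk0] using this
  have Dx : d1 - d3 = 0 := by
    have : k * (d1 - d3) = 0 := by
      have : k * (y * (d0 - d1 - d2 + d3) + (d1 - d3)) = 0 := by
        rw [hd0, hd1, hd2, hd3]; linear_combination k1 - k0
      rw [D] at this; simpa using this
    simpa [hk0] using this
  have Dy : d2 - d3 = 0 := by
    have : k * (d2 - d3) = 0 := by
      have : k * (x * (d0 - d1 - d2 + d3) + (d2 - d3)) = 0 := by
        rw [hd0, hd1, hd2, hd3]; linear_combination k2 - k0
      rw [D] at this; simpa using this
    simpa [hk0] using this
  have D3 : d3 = 0 := by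
    have : x * y * (d0 - d1 - d2 + d3) + x * (d1 - d3) + y * (d2 - d3) + d3 = 0 := by
      rw [hd0, hd1, hd2, hd3]; linear_combination k0
    rw [D, Dx, Dy] at this; simpa using this
  have r0 : S q' 0 = S q 0 := by linarith
  have r1 : S q' 1 = S q 1 := by linarith
  have r2 : S q' 2 = S q 2 := by linarith
  have r3 : S q' 3 = S q 3 := by linarith
  rw [r0, r1, r2, r3] at hcon
  exact lt_irrefl _ hcon

/-- Near opposite corners, the corner outcomes are ordered as expected. -/
theorem aux_eps {S : ℝ × ℝ → Fin 4 → ℝ} (hS : StrictlyProper2D S) (hT : Tech2D S) :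
    ∃ e : ℝ, 0 < e ∧ e < 1 / 2 ∧ S (e, e) 0 < S (1 - e, 1 - e) 0 ∧
      S (1 - e, 1 - e) 3 < S (e, e) 3 := by
  have b0 : ((0, 0) : ℝ × ℝ) ∈ box2 := aux_mem.2 (by simp)
  have b1 : ((1, 1) : ℝ × ℝ) ∈ box2 := aux_mem.2 (by simp)
  have s0 := hS (1, 1) b1 (0, 0) b0 (by simp)
  have s3 := hS (0, 0) b0 (1, 1) b1 (by simp)
  simp [aux_dot] at s0 s3
  have mA : Set.MapsTo (fun e : ℝ => ((e, e) : ℝ × ℝ)) (Set.Icc 0 1) box2 := fun e he =>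
    aux_mem.2 ⟨he, he⟩
  have mB : Set.MapsTo (fun e : ℝ => ((1 - e, 1 - e) : ℝ × ℝ)) (Set.Icc 0 1) box2 := fun e he =>
    aux_mem.2 (by simp [he.1, he.2])
  have cA : ∀ j, ContinuousWithinAt (fun e : ℝ => S (e, e) j) (Set.Icc 0 1) 0 := fun j =>
    (((continuous_apply j).comp_continuousOn hT.1).comp (f := fun e : ℝ => ((e, e) : ℝ × ℝ))
      (by fun_prop) mA) 0 (by simp)
  have cB : ∀ j, ContinuousWithinAt (fun e : ℝ => S (1 - e, 1 - e) j) (Set.Icc 0 1) 0 := fun j =>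
    (((continuous_apply j).comp_continuousOn hT.1).comp
      (f := fun e : ℝ => ((1 - e, 1 - e) : ℝ × ℝ)) (by fun_prop) mB) 0 (by simp)
  have t1 : ∀ᶠ e in nhdsWithin (0:ℝ) (Set.Icc 0 1), S (e, e) 0 < S (1 - e, 1 - e) 0 :=
    (cA 0).eventually_lt (cB 0) (by simpa using s0)
  have t2 : ∀ᶠ e in nhdsWithin (0:ℝ) (Set.Icc 0 1), S (1 - e, 1 - e) 3 < S (e, e) 3 :=
    (cB 3).eventually_lt (cA 3) (by simpa using s3)
  obtain ⟨ε, hε, hb⟩ := Metric.eventually_nhds_iff.1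
    (eventually_nhdsWithin_iff.1 (t1.and t2))
  obtain ⟨e, he0, he1, he2⟩ : ∃ e : ℝ, 0 < e ∧ e < ε ∧ e < 1 / 2 :=
    ⟨min (ε / 2) (1 / 4), by positivity, (min_le_left _ _).trans_lt (by linarith),
      (min_le_right _ _).trans_lt (by norm_num)⟩
  have := hb (y := e) (by rw [Real.dist_eq, sub_zero, abs_of_pos he0]; exact he1)
    ⟨he0.le, by linarith⟩
  exact ⟨e, he0, he2, this.1, this.2⟩

/-- Theorem `2dimpossibility`: there is no two-dimensional scoring rule
`S : [0,1]² → ℝ⁴` that is strictly proper, satisfies the technical assumptions (continuity on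
`[0,1]²`, differentiability on `(0,1)²`, componentwise quasiconcavity), and satisfies the
budget-constrained truthfulness property. -/
theorem stmt9 :
    ¬ ∃ S : ℝ × ℝ → Fin 4 → ℝ, StrictlyProper2D S ∧ Tech2D S ∧ BCT2D S := by
  rintro ⟨S, hS, hT, hB⟩
  obtain ⟨e, he0, he1, ht0, ht3⟩ := aux_eps hS hT
  have hA : ((e, e) : ℝ × ℝ) ∈ openBox2 := ⟨⟨he0, by simp; linarith⟩, ⟨he0, by simp; linarith⟩⟩
  have hC : ((1 - e, 1 - e) : ℝ × ℝ) ∈ openBox2 :=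
    ⟨⟨by simp; linarith, by simp; linarith⟩, ⟨by simp; linarith, by simp; linarith⟩⟩
  have hA' := mem_of_mem_nhds (aux_nhds hA)
  have hC' := mem_of_mem_nhds (aux_nhds hC)
  have hne1 : e ≠ 1 - e := by intro h; linarith
  have hne : ((e, e) : ℝ × ℝ) ≠ (1 - e, 1 - e) := fun h => hne1 (congrArg Prod.fst h)
  have hC1 : 0 < (1 - e) := by linarith
  have hC2 : (1 - e) < 1 := by linarith
  have hA2 : e < 1 := by linarith
  generalize hq0 : ((e, e) : ℝ × ℝ) = q₀ at *
  generalize hq1 : ((1 - e, 1 - e) : ℝ × ℝ) = q₁ at *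
  rcases le_or_gt (S q₀ 1) (S q₁ 1) with h | h
  · rcases lt_trichotomy (S q₀ 2 - S q₁ 2) (S q₀ 3 - S q₁ 3) with g | g | g
    · refine aux_unique hS hT hB (o := 3) hA hC hne ?_
      intro j hj
      fin_cases j <;> simp at hj ⊢ <;> linarith
    · refine aux_tieB hS hB hA' hC' ?_ ?_ ?_ g ?_
      · rw [← hq1]; exact hC1
      · rw [← hq1]; exact hC2
      · rw [← hq1, ← hq0]; exact hne1
      · intro j
        fin_cases j <;> simp <;> linarith
    · by_cases hp : 0 < S q₀ 2 - S q₁ 2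
      · refine aux_unique hS hT hB (o := 2) hA hC hne ?_
        intro j hj
        fin_cases j <;> simp at hj ⊢ <;> linarith
      · linarith
  · rcases lt_trichotomy (S q₁ 2 - S q₀ 2) (S q₁ 0 - S q₀ 0) with g | g | g
    · refine aux_unique hS hT hB (o := 0) hC hA hne.symm ?_
      intro j hj
      fin_cases j <;> simp at hj ⊢ <;> linarith
    · refine aux_tieL hS hB hC' hA' ?_ ?_ ?_ g ?_
      · rw [← hq0]; exact he0
      · rw [← hq0]; exact hA2
      · rw [← hq1, ← hq0]; exact hne1.symm
      · intro j
        fin_cases j <;> simp <;> linarith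
    · refine aux_unique hS hT hB (o := 2) hC hA hne.symm ?_
      intro j hj
      fin_cases j <;> simp at hj ⊢ <;> linarith
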